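/- For every M ≥ 1: u_1^{(M)} + Σ_{j=1}^{M} (−1)^j · u_{j+1}^{(M)} · I_{1,t} I_{2,t} ⋯ I_{j,t} = 0 in the polynomial ring R. -/

import Mathlib

/-- The two arrow symbols `↙` (`sw`) and `↘` (`se`). -/
inductive Arrow : Type
  | sw  -- ↙ : multiply by `I_{1,t+r}`
  | se  -- ↘ : apply the shift `σ`
deriving DecidableEq

instance : Fintype Arrow where
  elems := {Arrow.sw, Arrow.se}
  complete := by intro x; cases x <;> simp

/-- The ring `R = ℂ[I_{n,s} : n, s ∈ ℤ]`, realized as multivariate polynomials in the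
variables `(n, s) : ℤ × ℤ` (the variable `(n, s)` is the indeterminate `I_{n,s}`). -/
abbrev TodaRing : Type := MvPolynomial (ℤ × ℤ) ℂ

/-- The shift homomorphism `σ : R → R`, `σ(I_{n,s}) = I_{n+1,s}`. -/
noncomputable def shiftσ : TodaRing →ₐ[ℂ] TodaRing :=
  MvPolynomial.rename (fun p => (p.1 + 1, p.2))

/-- Auxiliary bracket, recursing on the *last* element of the sequence: the argument list is
the sequence `(a_1, …, a_r)` in reverse order. -/
noncomputable def bracketAux (t : ℤ) : List Arrow → TodaRing
  | [] => 1
  | Arrow.sw :: rest => MvPolynomial.X ((1 : ℤ), t + rest.length) * bracketAux t rest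
  | Arrow.se :: rest => shiftσ (bracketAux t rest)

/-- The bracket `{(a_1, …, a_r)} ∈ R`, defined by `{()} = 1`,
`{(a_1, …, a_r, ↙)} = I_{1,t+r} · {(a_1, …, a_r)}` and
`{(a_1, …, a_r, ↘)} = σ({(a_1, …, a_r)})`. -/
noncomputable def bracket (t : ℤ) (a : List Arrow) : TodaRing :=
  bracketAux t a.reverse

/-- `u_j^{(k)}`: the sum of `{a}` over all sequences `a ∈ {↙,↘}^k` containing exactly
`j - 1` symbols `↘`. -/
noncomputable def uSum (t : ℤ) (j k : ℕ) : TodaRing :=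
  ∑ a ∈ Finset.univ.filter
      (fun a : Fin k → Arrow => (List.ofFn a).count Arrow.se = j - 1),
    bracket t (List.ofFn a)

lemma bracketAux_append_sw (t : ℤ) (l : List Arrow) :
    bracketAux t (l ++ [Arrow.sw]) =
      MvPolynomial.X ((1 : ℤ) + l.count Arrow.se, t) * bracketAux (t + 1) l := by
  induction l with
  | nil => simp [bracketAux]
  | cons a l ih =>
    cases a with
    | sw =>
      have h : t + ((l.length : ℤ) + 1) = t + 1 + l.length := by ring
      simp [bracketAux, ih, h]
      ring
    | se =>
      have h : (1 : ℤ) + l.count Arrow.se + 1 = 1 + (l.count Arrow.se + 1) := by ring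
      simp [bracketAux, ih, shiftσ, h]

lemma bracketAux_append_se (t : ℤ) (l : List Arrow) :
    bracketAux t (l ++ [Arrow.se]) = bracketAux (t + 1) l := by
  induction l with
  | nil => simp [bracketAux]
  | cons a l ih =>
    cases a with
    | sw =>
      have h : t + ((l.length : ℤ) + 1) = t + 1 + l.length := by ring
      simp [bracketAux, ih, h]
    | se => simp [bracketAux, ih]

lemma sum_arrow (f : Arrow → TodaRing) : ∑ a, f a = f Arrow.sw + f Arrow.se := by
  have h : (Finset.univ : Finset Arrow) = {Arrow.sw, Arrow.se} := rfl
  rw [h, Finset.sum_pair (by simp)]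

lemma uSum_split (t : ℤ) (j N : ℕ) :
    uSum t (j + 1) (N + 1) =
      MvPolynomial.X ((1 : ℤ) + j, t) * uSum (t + 1) (j + 1) N +
      ∑ b : Fin N → Arrow, if (List.ofFn b).count Arrow.se + 1 = j
        then bracket (t + 1) (List.ofFn b) else 0 := by
  unfold uSum
  rw [Finset.sum_filter, Finset.sum_filter,
    ← (Fin.consEquiv (fun _ : Fin (N + 1) => Arrow)).sum_comp, Fintype.sum_prod_type, sum_arrow,
    Finset.mul_sum]
  congr 1
  · refine Finset.sum_congr rfl fun b _ => ?_
    simp only [Fin.consEquiv, Equiv.coe_fn_mk, List.ofFn_succ, Fin.cons_zero, Fin.cons_succ,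
      bracket, List.reverse_cons, bracketAux_append_sw, List.count_reverse]
    by_cases h : (List.ofFn b).count Arrow.se = j
    · simp [h]
    · simp [h]
  · refine Finset.sum_congr rfl fun b _ => ?_
    simp [Fin.consEquiv, List.ofFn_succ, bracket, bracketAux_append_se]

lemma uSum_one_succ (t : ℤ) (N : ℕ) :
    uSum t 1 (N + 1) = MvPolynomial.X ((1 : ℤ), t) * uSum (t + 1) 1 N := by
  have := uSum_split t 0 N
  simpa using this

lemma uSum_succ_succ (t : ℤ) (j N : ℕ) :
    uSum t (j + 2) (N + 1) =
      MvPolynomial.X ((1 : ℤ) + (j + 1 : ℕ), t) * uSum (t + 1) (j + 2) N +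
        uSum (t + 1) (j + 1) N := by
  rw [uSum_split t (j + 1) N]
  congr 1
  unfold uSum
  rw [Finset.sum_filter]
  simp

lemma uSum_eq_zero (t : ℤ) (N : ℕ) : uSum t (N + 2) N = 0 := by
  unfold uSum
  rw [Finset.filter_false_of_mem, Finset.sum_empty]
  intro a _ h
  have := List.count_le_length (a := Arrow.se) (l := List.ofFn a)
  rw [List.length_ofFn] at this
  omega

lemma partial_telescope (t : ℤ) (N K : ℕ) :
    uSum t 1 (N + 1) + ∑ j ∈ Finset.Icc 1 K, (-1 : TodaRing) ^ j * uSum t (j + 1) (N + 1) *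
        ∏ i ∈ Finset.Icc 1 j, MvPolynomial.X (((i : ℤ), t)) =
      (-1 : TodaRing) ^ K * uSum (t + 1) (K + 1) N *
        ∏ i ∈ Finset.Icc 1 (K + 1), MvPolynomial.X (((i : ℤ), t)) := by
  induction K with
  | zero => simp [uSum_one_succ]; ring
  | succ K ih =>
    rw [Finset.sum_Icc_succ_top (by omega), ← add_assoc, ih, uSum_succ_succ,
      Finset.prod_Icc_succ_top (b := K + 1) (by omega)]
    have h : ((K + 1 + 1 : ℕ) : ℤ) = 1 + (K + 1 : ℕ) := by push_cast; ring
    rw [h]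
    ring

/-- Lemma B of the appendix: for every `M ≥ 1`,
`u_1^{(M)} + ∑_{j=1}^M (-1)^j u_{j+1}^{(M)} I_{1,t} ⋯ I_{j,t} = 0` in `R`. -/
theorem uSum_alternating_relation (t : ℤ) (M : ℕ) (hM : 1 ≤ M) :
    uSum t 1 M + ∑ j ∈ Finset.Icc 1 M, (-1 : TodaRing) ^ j * uSum t (j + 1) M *
        ∏ i ∈ Finset.Icc 1 j, MvPolynomial.X (((i : ℤ), t)) = 0 := by
  obtain ⟨N, rfl⟩ : ∃ N, M = N + 1 := ⟨M - 1, by omega⟩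
  rw [partial_telescope, uSum_eq_zero]
  simp
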